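/- Let χ = 0 and λ ∈ F_p. Then Ext(K, V_0(λ)), taken in the category of restricted W-modules (U_0(W)-modules), is isomorphic to K if λ ∈ {0, 1}, and is 0 otherwise. Here K denotes the one-dimensional trivial W-module. -/

import Mathlib

/-!
Common setup: the Witt algebra `W` over `K` (char `p > 3`) has basis
`e_{-1}, e_0, ..., e_{p-2}` with `[e_i, e_j] = (j-i) e_{i+j}` (and `e_k = 0`
outside the range), and `p`-mapping `e_i^{[p]} = δ_{i0} e_i`.  A module with
`p`-character `χ` over `W` (resp. the subalgebra `W_0 = <e_0, ..., e_{p-2}>`)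
is given by a family of endomorphisms `ρ k` (`k : ℤ`, vanishing outside
`[lo, p-2]` where `lo = -1` for `W` and `lo = 0` for `W_0`) satisfying the
bracket relations and `(ρ i)^p - δ_{i0} ρ i = χ(e_i)^p • 1`.

The Baer Ext space `Ext(N, M)` of two such modules, in the category of
modules with `p`-character `χ`, is realized concretely: an extension
`0 → M → E → N → 0` admits a linear splitting `E ≃ M ⊕ N`, under which the
action of `e_k` is `(m, n) ↦ (ρM k m + c k n, ρN k n)` for a "cocycle"
`c : ℤ → (N →ₗ M)`; the conditions for `E` to be a module with `p`-character
`χ` are the cocycle conditions below, Baer equivalence corresponds to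
differing by a coboundary, and the Baer sum / scalar action correspond to the
linear structure on cocycles.  So `Ext(N, M) ≅ cocycles / coboundaries`.
-/

set_option maxHeartbeats 1000000
set_option synthInstance.maxHeartbeats 1000000

noncomputable section

/-- The coefficient `(-1)^j · (i!/(i-j)!) · ((j+1)λ - i + j)` of the action
`e_j · v_i = (coefficient) · v_{i-j}` on the reduced Verma module; it vanishes
for `j > i` since then `Nat.descFactorial i j = 0`. -/
def wCoef (K : Type) [Field K] (lam : K) (j i : ℕ) : K :=
  (-1 : K) ^ j * (Nat.descFactorial i j : K) * (((j : K) + 1) * lam - (i : K) + (j : K))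

/-- Matrices (in the basis `v_0, ..., v_{p-1}`) of the generators `e_j`
(`j : ℤ`) acting on the reduced Verma module `V_χ(λ)`; here `c = χ(e_{-1})^p`.
`e_{-1} v_i = v_{i+1}` for `i < p-1`, `e_{-1} v_{p-1} = c v_0`, and for
`0 ≤ j ≤ p-2`, `e_j v_i = (-1)^j (i!/(i-j)!) ((j+1)λ - i + j) v_{i-j}`. -/
def vermaMat (K : Type) [Field K] (p : ℕ) (c lam : K) : ℤ → Matrix (Fin p) (Fin p) K :=
  fun j =>
    if j = -1 then
      Matrix.of fun k l =>
        if (k : ℕ) = (l : ℕ) + 1 then 1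
        else if (k : ℕ) = 0 ∧ (l : ℕ) = p - 1 then c else 0
    else if 0 ≤ j ∧ j ≤ (p : ℤ) - 2 then
      Matrix.of fun k l =>
        if (l : ℕ) = (k : ℕ) + j.toNat then wCoef K lam j.toNat (l : ℕ) else 0
    else 0

/-- The action of the basis elements `e_j` (`j : ℤ`) on the reduced Verma
module `V_χ(λ)`, with `c = χ(e_{-1})^p`. -/
def vermaRho (K : Type) [Field K] (p : ℕ) (c lam : K) : ℤ → Module.End K (Fin p → K) :=
  fun j => Matrix.toLin' (vermaMat K p c lam j)

/-- The one-dimensional `W_0`-module `K_λ`: `e_0` acts by `λ`, all other `e_j` act by `0`. -/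
def oneDimRho (K : Type) [Field K] (lam : K) : ℤ → Module.End K K :=
  fun j => if j = 0 then lam • (1 : Module.End K K) else 0

/-- The one-dimensional trivial module: every basis element acts by `0`. -/
def trivRho (K : Type) [Field K] : ℤ → Module.End K K := fun _ => 0

/-- The coefficient `(-1)^(j+1) · ((i+1)!/(i-j)!)` of the action
`e_j · u_i = (coefficient) · u_{i-j}` on the `(p-1)`-dimensional simple module `S`. -/
def sCoef (K : Type) [Field K] (j i : ℕ) : K :=
  (-1 : K) ^ (j + 1) * (Nat.descFactorial (i + 1) (j + 1) : K)

/-- Matrices (in the basis `u_0, ..., u_{p-2}`) of the generators `e_j` acting on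
the `(p-1)`-dimensional simple restricted module `S = V_0(p-1)/Soc(V_0(p-1))`. -/
def sMat (K : Type) [Field K] (p : ℕ) : ℤ → Matrix (Fin (p - 1)) (Fin (p - 1)) K :=
  fun j =>
    if j = -1 then
      Matrix.of fun k l => if (k : ℕ) = (l : ℕ) + 1 then 1 else 0
    else if 0 ≤ j ∧ j ≤ (p : ℤ) - 2 then
      Matrix.of fun k l =>
        if (l : ℕ) = (k : ℕ) + j.toNat then sCoef K j.toNat (l : ℕ) else 0
    else 0

/-- The action of the basis elements `e_j` on the simple module `S`. -/
def sRho (K : Type) [Field K] (p : ℕ) : ℤ → Module.End K (Fin (p - 1) → K) :=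
  fun j => Matrix.toLin' (sMat K p j)

section ExtSpace

variable (K : Type) [Field K] (M N : Type) [AddCommGroup M] [Module K M]
  [AddCommGroup N] [Module K N]

/-- Constraint: a cocycle vanishes outside the index range `[lo, p-2]`. -/
def suppConstraint (p : ℕ) (lo k : ℤ) : (ℤ → N →ₗ[K] M) →ₗ[K] (N →ₗ[K] M) :=
  if k < lo ∨ (p : ℤ) - 2 < k then LinearMap.proj k else 0

variable {M N}

/-- Constraint on a cocycle coming from the bracket relation
`[e_i, e_j] = (j - i) e_{i+j}`:
`(j-i) c(i+j) = ρM i ∘ c j + c i ∘ ρN j - ρM j ∘ c i - c j ∘ ρN i`. -/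
def bracketConstraint (p : ℕ) (lo : ℤ) (ρM : ℤ → Module.End K M)
    (ρN : ℤ → Module.End K N) (i j : ℤ) :
    (ℤ → N →ₗ[K] M) →ₗ[K] (N →ₗ[K] M) :=
  if lo ≤ i ∧ i ≤ (p : ℤ) - 2 ∧ lo ≤ j ∧ j ≤ (p : ℤ) - 2 then
    ((j - i : ℤ) : K) • LinearMap.proj (i + j)
      - LinearMap.llcomp K N M M (ρM i) ∘ₗ LinearMap.proj j
      - LinearMap.lcomp K M (ρN j) ∘ₗ LinearMap.proj i
      + LinearMap.llcomp K N M M (ρM j) ∘ₗ LinearMap.proj i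
      + LinearMap.lcomp K M (ρN i) ∘ₗ LinearMap.proj j
  else 0

/-- Constraint on a cocycle expressing that the extension has `p`-character `χ`:
on the extension `E = M ⊕ N` the `(N → M)`-component of `(e_i)^p` is
`∑_{k<p} (ρM i)^k ∘ c i ∘ (ρN i)^(p-1-k)`, and this must agree with the
`(N → M)`-component of `e_i^{[p]} + χ(e_i)^p • 1`, which is `δ_{i0} c i`
(the scalar `χ(e_i)^p` contributes nothing off the diagonal, and the diagonal
blocks hold since `M`, `N` have `p`-character `χ`). -/
def pcharConstraint (p : ℕ) (lo : ℤ) (ρM : ℤ → Module.End K M)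
    (ρN : ℤ → Module.End K N) (i : ℤ) :
    (ℤ → N →ₗ[K] M) →ₗ[K] (N →ₗ[K] M) :=
  if lo ≤ i ∧ i ≤ (p : ℤ) - 2 then
    (∑ k ∈ Finset.range p,
        LinearMap.llcomp K N M M ((ρM i) ^ k) ∘ₗ
          LinearMap.lcomp K M ((ρN i) ^ (p - 1 - k)) ∘ₗ LinearMap.proj i)
      - (if i = 0 then (LinearMap.proj 0 : (ℤ → N →ₗ[K] M) →ₗ[K] (N →ₗ[K] M)) else 0)
  else 0

/-- The space of cocycles: families `c : ℤ → (N →ₗ M)` (the values of a linear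
map `W → Hom(N, M)` on the basis, `lo = -1` for `W` and `lo = 0` for `W_0`)
such that `M ⊕ N` with action `e_k (m, n) = (ρM k m + c k n, ρN k n)` is a
module with `p`-character `χ`. -/
def cocycles (p : ℕ) (lo : ℤ) (ρM : ℤ → Module.End K M) (ρN : ℤ → Module.End K N) :
    Submodule K (ℤ → N →ₗ[K] M) :=
  (⨅ k : ℤ, LinearMap.ker (suppConstraint K M N p lo k)) ⊓
    (⨅ i : ℤ, ⨅ j : ℤ, LinearMap.ker (bracketConstraint K p lo ρM ρN i j)) ⊓
    (⨅ i : ℤ, LinearMap.ker (pcharConstraint K p lo ρM ρN i))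

/-- The coboundaries: cocycles of the form `k ↦ ρM k ∘ f - f ∘ ρN k` for a
linear map `f : N → M`; these are exactly the cocycles of split extensions,
and two cocycles give Baer-equivalent extensions iff they differ by a
coboundary. -/
def coboundaries (p : ℕ) (lo : ℤ) (ρM : ℤ → Module.End K M) (ρN : ℤ → Module.End K N) :
    Submodule K (ℤ → N →ₗ[K] M) :=
  LinearMap.range (LinearMap.pi fun k : ℤ =>
    if lo ≤ k ∧ k ≤ (p : ℤ) - 2 then
      LinearMap.llcomp K N M M (ρM k) - LinearMap.lcomp K M (ρN k)
    else 0)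

/-- The Baer Ext space `Ext(N, M)` in the category of modules with
`p`-character `χ` (over `W` if `lo = -1`, over `W_0` if `lo = 0`), realized
as cocycles modulo coboundaries. -/
abbrev extSpace (p : ℕ) (lo : ℤ) (ρM : ℤ → Module.End K M) (ρN : ℤ → Module.End K N) :=
  (cocycles K p lo ρM ρN) ⧸
    (Submodule.comap (cocycles K p lo ρM ρN).subtype (coboundaries K p lo ρM ρN))

end ExtSpace

end

section VermaCohomology

open scoped Nat

variable {K : Type} [Field K] {p : ℕ}

/-- The coordinates of a vector of `K^p`, extended by zero to all of `ℕ`. -/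
def coord (x : Fin p → K) (k : ℕ) : K := if h : k < p then x ⟨k, h⟩ else 0

lemma coord_of_le (x : Fin p → K) {k : ℕ} (h : p ≤ k) : coord x k = 0 :=
  dif_neg (not_lt.mpr h)

lemma coord_val (x : Fin p → K) (k : Fin p) : coord x k = x k := by
  simp [coord]

lemma coord_ext {x y : Fin p → K} (h : ∀ k < p, coord x k = coord y k) : x = y := by
  funext k
  rw [← coord_val x, ← coord_val y, h k k.isLt]

@[simp] lemma coord_zero (k : ℕ) : coord (0 : Fin p → K) k = 0 := by
  simp [coord]

@[simp] lemma coord_sub (x y : Fin p → K) (k : ℕ) :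
    coord (x - y) k = coord x k - coord y k := by
  unfold coord; split <;> simp

@[simp] lemma coord_smul (a : K) (x : Fin p → K) (k : ℕ) :
    coord (a • x) k = a * coord x k := by
  unfold coord; split <;> simp

lemma coord_vermaRho_nat (lam : K) {j : ℕ} (hj : j + 2 ≤ p) (x : Fin p → K) (k : ℕ) :
    coord (vermaRho K p 0 lam j x) k = wCoef K lam j (k + j) * coord x (k + j) := by
  by_cases hk : k < p
  · have h1 : ¬ ((j : ℤ) = -1) := by omega
    have h2 : (0 : ℤ) ≤ j ∧ (j : ℤ) ≤ (p : ℤ) - 2 := by omega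
    simp only [coord, hk, dif_pos, vermaRho, vermaMat, h1, h2, if_false, if_true,
      Matrix.toLin'_apply, Matrix.mulVec, dotProduct, Matrix.of_apply, Int.toNat_natCast,
      and_self]
    by_cases hkj : k + j < p
    · rw [Finset.sum_eq_single ⟨k + j, hkj⟩]
      · simp [hkj]
      · intro b _ hb
        have : (b : ℕ) ≠ k + j := fun h => hb (Fin.ext h)
        simp [this]
      · simp
    · rw [dif_neg hkj, mul_zero]
      refine Finset.sum_eq_zero fun b _ => ?_
      have : (b : ℕ) ≠ k + j := by have := b.isLt; omega
      simp [this]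
  · rw [coord_of_le _ (by omega), coord_of_le _ (by omega), mul_zero]

lemma coord_vermaRho_neg_one (lam : K) (x : Fin p → K) (k : ℕ) :
    coord (vermaRho K p 0 lam (-1) x) k =
      if 1 ≤ k ∧ k < p then coord x (k - 1) else 0 := by
  by_cases hk : k < p
  · simp only [coord, hk, dif_pos, vermaRho, vermaMat, if_true,
      Matrix.toLin'_apply, Matrix.mulVec, dotProduct, Matrix.of_apply, ite_self, and_true]
    by_cases h1 : 1 ≤ k
    · rw [if_pos h1, dif_pos (by omega), Finset.sum_eq_single ⟨k - 1, by omega⟩]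
      · rw [if_pos (by simp; omega), one_mul]
      · intro b _ hb
        have : k ≠ (b : ℕ) + 1 := fun h => hb (Fin.ext (by simp; omega))
        simp [this]
      · simp
    · rw [if_neg h1]
      refine Finset.sum_eq_zero fun b _ => ?_
      have : k ≠ (b : ℕ) + 1 := by omega
      simp [this]
  · rw [coord_of_le _ (by omega), if_neg (by omega)]

lemma vermaRho_of_not_mem (hp : 3 < p) (lam : K) {j : ℤ} (h : j < -1 ∨ (p : ℤ) - 2 < j) :
    vermaRho K p 0 lam j = 0 := by
  have h1 : j ≠ -1 := by omega
  have h2 : ¬ (0 ≤ j ∧ j ≤ (p : ℤ) - 2) := by omega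
  simp [vermaRho, vermaMat, h1, h2]

/-- A family of vectors satisfying the bracket relations of a `1`-cocycle with values in the
reduced Verma module. -/
def SatisfiesBracket (lam : K) (W : ℤ → Fin p → K) : Prop :=
  ∀ i j : ℤ, -1 ≤ i → i ≤ (p : ℤ) - 2 → -1 ≤ j → j ≤ (p : ℤ) - 2 →
    ((j - i : ℤ) : K) • W (i + j) =
      vermaRho K p 0 lam i (W j) - vermaRho K p 0 lam j (W i)

lemma satisfiesBracket_of_nat {lam : K} {W : ℤ → Fin p → K}
    (hnat : ∀ i j : ℕ, i + 2 ≤ p → j + 2 ≤ p → ((j : K) - i) • W ((i + j : ℕ) : ℤ) =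
      vermaRho K p 0 lam i (W j) - vermaRho K p 0 lam j (W i))
    (hneg : ∀ j : ℕ, j + 2 ≤ p → ((j : K) + 1) • W ((j : ℤ) - 1) =
      vermaRho K p 0 lam (-1) (W j) - vermaRho K p 0 lam j (W (-1))) :
    SatisfiesBracket lam W := by
  intro i j hi hi' hj hj'
  obtain rfl | hi0 := hi.eq_or_lt
  · obtain rfl | hj0 := hj.eq_or_lt
    · simp
    · lift j to ℕ using by omega
      have := hneg j (by omega)
      rw [← this, show (-1 + (j : ℤ)) = j - 1 by ring]
      push_cast
      congr 1
      ring
  · lift i to ℕ using by omega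
    obtain rfl | hj0 := hj.eq_or_lt
    · have := hneg i (by omega)
      rw [← neg_sub (vermaRho K p 0 lam (-1) _), ← this,
        show ((i : ℤ) + -1) = i - 1 by ring, ← neg_smul]
      push_cast
      congr 1
      ring
    · lift j to ℕ using by omega
      rw [← hnat i j (by omega) (by omega)]
      push_cast
      rfl

lemma mem_cocycles_iff (lam : K) (c : ℤ → K →ₗ[K] (Fin p → K)) (hp : 3 < p) :
    c ∈ cocycles K p (-1) (vermaRho K p 0 lam) (trivRho K) ↔
      (∀ k : ℤ, k < -1 ∨ (p : ℤ) - 2 < k → c k 1 = 0) ∧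
      SatisfiesBracket lam (fun j => c j 1) ∧
      (∀ i : ℤ, -1 ≤ i → i ≤ (p : ℤ) - 2 →
        (vermaRho K p 0 lam i ^ (p - 1)) (c i 1) = if i = 0 then c 0 1 else 0) := by
  have hsum (i : ℤ) : (∑ k ∈ Finset.range p,
        LinearMap.llcomp K K (Fin p → K) (Fin p → K) ((vermaRho K p 0 lam i) ^ k) ∘ₗ
          LinearMap.lcomp K (Fin p → K) ((trivRho K i) ^ (p - 1 - k)) ∘ₗ
            (LinearMap.proj i : (ℤ → K →ₗ[K] (Fin p → K)) →ₗ[K] _)) c =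
        (vermaRho K p 0 lam i ^ (p - 1)) ∘ₗ c i := by
    rw [LinearMap.sum_apply, Finset.sum_eq_single (p - 1)]
    · ext
      simp
    · intro k hk hk'
      have : p - 1 - k ≠ 0 := by have := Finset.mem_range.mp hk; omega
      ext
      simp [trivRho, this]
    · intro h
      exact absurd (Finset.mem_range.mpr (by omega)) h
  simp only [cocycles, Submodule.mem_inf, Submodule.mem_iInf, LinearMap.mem_ker, and_assoc]
  refine and_congr (forall_congr' fun k => ?_) (and_congr ?_ (forall_congr' fun i => ?_))
  · unfold suppConstraint
    split_ifs with h
    · simp [h, LinearMap.ext_ring_iff]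
    · simp [h]
  · refine forall_congr' fun i => forall_congr' fun j => ?_
    unfold bracketConstraint
    split_ifs with h
    · obtain ⟨h1, h2, h3, h4⟩ := h
      simp only [h1, h2, h3, h4, forall_true_left, LinearMap.ext_ring_iff]
      rw [← sub_eq_zero]
      simp [trivRho, sub_add, sub_sub, sub_eq_zero]
    · simp only [LinearMap.zero_apply, true_iff]
      intro h1 h2 h3 h4
      exact absurd ⟨h1, h2, h3, h4⟩ h
  · unfold pcharConstraint
    by_cases h : -1 ≤ i ∧ i ≤ (p : ℤ) - 2
    · rw [if_pos h, LinearMap.sub_apply, hsum, sub_eq_zero, LinearMap.ext_ring_iff]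
      obtain ⟨h1, h2⟩ := h
      simp only [h1, h2, forall_true_left]
      by_cases h0 : i = 0 <;> simp [h0]
    · rw [if_neg h]
      simp only [LinearMap.zero_apply, true_iff]
      intro h1 h2
      exact absurd ⟨h1, h2⟩ h

lemma mem_coboundaries_iff (hp : 3 < p) (lam : K) (c : ℤ → K →ₗ[K] (Fin p → K)) :
    c ∈ coboundaries K p (-1) (vermaRho K p 0 lam) (trivRho K) ↔
      ∃ u : Fin p → K, ∀ j, c j 1 = vermaRho K p 0 lam j u := by
  have key (f : K →ₗ[K] (Fin p → K)) (j : ℤ) :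
      (if -1 ≤ j ∧ j ≤ (p : ℤ) - 2 then
        LinearMap.llcomp K K (Fin p → K) (Fin p → K) (vermaRho K p 0 lam j)
          - LinearMap.lcomp K (Fin p → K) (trivRho K j)
        else (0 : (K →ₗ[K] (Fin p → K)) →ₗ[K] (K →ₗ[K] (Fin p → K)))) f 1 =
        vermaRho K p 0 lam j (f 1) := by
    split_ifs with h
    · simp [trivRho]
    · rw [vermaRho_of_not_mem hp lam (by omega)]
      simp
  rw [coboundaries, LinearMap.mem_range]
  constructor
  · rintro ⟨f, rfl⟩
    exact ⟨f 1, fun j => key f j⟩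
  · rintro ⟨u, hu⟩
    refine ⟨LinearMap.toSpanSingleton K _ u, funext fun j => LinearMap.ext_ring ?_⟩
    rw [hu]
    refine (key _ j).trans ?_
    simp

lemma coord_vermaRho_nat_pow (lam : K) {j : ℕ} (hj : j + 2 ≤ p) (x : Fin p → K) (n k : ℕ)
    (h : p ≤ k + j * n) : coord ((vermaRho K p 0 lam j ^ n) x) k = 0 := by
  induction n generalizing k with
  | zero => exact coord_of_le _ (by simpa using h)
  | succ n ih =>
    rw [pow_succ', Module.End.mul_apply, coord_vermaRho_nat lam hj,
      ih _ (by rw [mul_add] at h; omega), mul_zero]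

lemma coord_vermaRho_neg_one_pow (lam : K) (x : Fin p → K) (n k : ℕ) (hk : k < p) :
    coord ((vermaRho K p 0 lam (-1) ^ n) x) k = if n ≤ k then coord x (k - n) else 0 := by
  induction n generalizing k with
  | zero => simp
  | succ n ih =>
    rw [pow_succ', Module.End.mul_apply, coord_vermaRho_neg_one]
    by_cases h : 1 ≤ k
    · rw [if_pos ⟨h, hk⟩, ih _ (by omega), show k - 1 - n = k - (n + 1) by omega]
      simp only [show n ≤ k - 1 ↔ n + 1 ≤ k by omega]
    · rw [if_neg (by omega), if_neg (by omega)]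

lemma coord_vermaRho_zero (lam : K) (hp : 3 < p) (x : Fin p → K) (k : ℕ) :
    coord (vermaRho K p 0 lam 0 x) k = (lam - k) * coord x k := by
  have := coord_vermaRho_nat lam (j := 0) (by omega) x k
  rw [Nat.cast_zero] at this
  rw [this]
  simp [wCoef]

lemma coord_vermaRho_zero_pow (lam : K) (hp : 3 < p) (x : Fin p → K) (n k : ℕ) :
    coord ((vermaRho K p 0 lam 0 ^ n) x) k = (lam - k) ^ n * coord x k := by
  induction n with
  | zero => simp
  | succ n ih =>
    rw [pow_succ', Module.End.mul_apply, coord_vermaRho_zero lam hp, ih]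
    ring

lemma descFactorial_add_right (l i j : ℕ) :
    l.descFactorial (i + j) = l.descFactorial i * (l - i).descFactorial j := by
  induction j with
  | zero => simp
  | succ j ih =>
    rw [← add_assoc, Nat.descFactorial_succ, Nat.descFactorial_succ, ih, Nat.sub_sub]
    ring

/-- The generating cocycle for `λ = m - 1`, where `m = 1` or `m = 2`. -/
def genVec (K : Type) [Field K] (p m : ℕ) (j : ℤ) : Fin p → K := fun k =>
  if 0 ≤ j ∧ j ≤ (p : ℤ) - 2 ∧ (k : ℤ) + j + 1 = p + m then ((j.toNat + 1)! : K) else 0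

lemma coord_genVec (m j k : ℕ) :
    coord (genVec K p m j) k =
      if k < p ∧ j + 2 ≤ p ∧ k + j + 1 = p + m then ((j + 1)! : K) else 0 := by
  unfold coord genVec
  by_cases hk : k < p
  · simp only [hk, dif_pos, Int.toNat_natCast, true_and]
    congr 1
    apply propext
    omega
  · simp [hk]

/-- The cochain attached to the family `genVec`. -/
def genCochain (K : Type) [Field K] (p m : ℕ) : ℤ → K →ₗ[K] (Fin p → K) :=
  fun j => LinearMap.toSpanSingleton K _ (genVec K p m j)

lemma genCochain_neg_one (m : ℕ) : genCochain K p m (-1) 1 = 0 := by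
  funext k
  simp [genCochain, genVec]

lemma genCochain_zero {m : ℕ} (hm : m = 1 ∨ m = 2) : genCochain K p m 0 1 = 0 := by
  funext k
  have := k.isLt
  rw [genCochain, LinearMap.toSpanSingleton_apply, one_smul, genVec, if_neg (by omega),
    Pi.zero_apply]

variable [CharP K p]

lemma satisfiesBracket_vermaRho (hp : 3 < p) (lam : K) (u : Fin p → K) :
    SatisfiesBracket lam (fun j => vermaRho K p 0 lam j u) := by
  have hpK : (p : K) = 0 := CharP.cast_eq_zero K p
  refine satisfiesBracket_of_nat (fun i j hi hj => coord_ext fun k hk => ?_)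
    (fun j hj => coord_ext fun k hk => ?_)
  · have prodCoef (i j : ℕ) : wCoef K lam i (k + i) * wCoef K lam j (k + i + j) =
        (-1) ^ (i + j) * ((k + i + j).descFactorial (i + j) : K) *
          (((i : K) + 1) * lam - k) * (((j : K) + 1) * lam - k - i) := by
      rw [show (k + i + j).descFactorial (i + j)
        = (k + i + j).descFactorial j * (k + i).descFactorial i by
          rw [add_comm i j, descFactorial_add_right, Nat.add_sub_cancel]]
      unfold wCoef
      push_cast
      ring
    simp only [coord_sub, coord_smul, coord_vermaRho_nat lam hi, coord_vermaRho_nat lam hj]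
    rw [← mul_assoc, ← mul_assoc, prodCoef, prodCoef, add_comm j i, add_right_comm k j i]
    rcases Nat.lt_or_ge (i + j) (p - 1) with h | h
    · rw [coord_vermaRho_nat lam (by omega : i + j + 2 ≤ p), wCoef, ← add_assoc]
      push_cast
      ring
    · rw [vermaRho_of_not_mem hp lam (by right; push_cast; omega)]
      rcases Nat.lt_or_ge (k + i + j) p with h' | h'
      · have e : ((i : K) + j + 1) = 0 := by
          rw [← hpK, show p = i + j + 1 by omega]
          push_cast
          ring
        have e' : k = 0 := by omega
        simp only [LinearMap.zero_apply, coord_zero, mul_zero, e', Nat.cast_zero]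
        linear_combination ((i : K) - j) * (-1) ^ (i + j) *
          ((0 + i + j).descFactorial (i + j) : K) * lam * coord u (0 + i + j) * e
      · rw [coord_of_le u h']
        simp
  · simp only [coord_sub, coord_smul, coord_vermaRho_nat lam hj]
    cases j with
    | zero =>
      simp only [Nat.cast_zero, zero_sub, zero_add, one_mul, add_zero,
        coord_vermaRho_neg_one, coord_vermaRho_zero lam hp]
      by_cases h : 1 ≤ k
      · rw [if_pos ⟨h, hk⟩, if_pos ⟨h, hk⟩, Nat.cast_sub h]
        simp only [wCoef, Nat.descFactorial_zero]
        push_cast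
        ring
      · rw [if_neg (by omega), if_neg (by omega)]
        ring
    | succ n =>
      have e : ((n + 1 : ℕ) : ℤ) - 1 = (n : ℤ) := by push_cast; ring
      rw [e, coord_vermaRho_nat lam (by omega)]
      have h1 : (if 1 ≤ k ∧ k < p then coord (vermaRho K p 0 lam ((n + 1 : ℕ) : ℤ) u) (k - 1)
          else 0) = wCoef K lam (n + 1) (k + n) * coord u (k + n) := by
        by_cases h : 1 ≤ k
        · rw [if_pos ⟨h, hk⟩, coord_vermaRho_nat lam hj, show k - 1 + (n + 1) = k + n by omega]
        · rw [if_neg (by omega), wCoef, Nat.descFactorial_of_lt (by omega)]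
          simp
      have h2 : wCoef K lam (n + 1) (k + (n + 1)) *
          (if 1 ≤ k + (n + 1) ∧ k + (n + 1) < p then coord u (k + (n + 1) - 1) else 0) =
          wCoef K lam (n + 1) (k + n + 1) * coord u (k + n) := by
        rcases lt_trichotomy (k + n + 1) p with h | h | h
        · rw [if_pos (by omega)]
          rfl
        · rw [if_neg (by omega), wCoef, wCoef, Nat.succ_descFactorial_succ, h]
          push_cast
          rw [hpK]
          ring
        · rw [if_neg (by omega), coord_of_le u (by omega)]
          ring
      rw [coord_vermaRho_neg_one, coord_vermaRho_neg_one, h1, h2, wCoef, wCoef, wCoef,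
        Nat.succ_descFactorial_succ, Nat.descFactorial_succ, Nat.add_sub_cancel]
      push_cast
      ring

lemma sub_natCast_pow_char (hp : 3 < p) {lam : K} (hlam : lam ^ p = lam) (k : ℕ) :
    (lam - k) ^ p = lam - k := by
  have : Fact p.Prime := ⟨(CharP.char_is_prime_or_zero K p).resolve_right (by omega)⟩
  rw [sub_pow_char, hlam, ← frobenius_def, map_natCast]

lemma coboundaries_le_cocycles (hp : 3 < p) {lam : K} (hlam : lam ^ p = lam) :
    coboundaries K p (-1) (vermaRho K p 0 lam) (trivRho K) ≤
      cocycles K p (-1) (vermaRho K p 0 lam) (trivRho K) := by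
  intro c hc
  obtain ⟨u, hu⟩ := (mem_coboundaries_iff hp lam c).mp hc
  rw [mem_cocycles_iff lam c hp]
  refine ⟨fun k hk => ?_, ?_, fun i hi hi' => ?_⟩
  · rw [hu, vermaRho_of_not_mem hp lam hk, LinearMap.zero_apply]
  · simp only [hu]
    exact satisfiesBracket_vermaRho hp lam u
  · rw [hu, hu, ← Module.End.mul_apply, ← pow_succ, Nat.sub_add_cancel (by omega)]
    refine coord_ext fun k hk => ?_
    obtain rfl | hi0 := hi.eq_or_lt
    · rw [coord_vermaRho_neg_one_pow lam u p k hk, if_neg (by omega), if_neg (by omega),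
        coord_zero]
    · lift i to ℕ using by omega
      rcases Nat.eq_zero_or_pos i with rfl | h
      · rw [Nat.cast_zero, coord_vermaRho_zero_pow lam hp, if_pos rfl,
          coord_vermaRho_zero lam hp, sub_natCast_pow_char hp hlam]
      · rw [coord_vermaRho_nat_pow lam (by omega) u p k (by nlinarith),
          if_neg (by omega), coord_zero]

lemma natCast_ne_zero_of_lt {n : ℕ} (h0 : 0 < n) (h : n < p) : (n : K) ≠ 0 := by
  rw [Ne, CharP.cast_eq_zero_iff K p]
  exact Nat.not_dvd_of_pos_of_lt h0 h

/-- Every cocycle is cohomologous to one vanishing on `e_{-1}` and `e_0`. -/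
lemma exists_normalized (hp : 3 < p) {lam : K} (hlam : lam ^ p = lam)
    {c : ℤ → K →ₗ[K] (Fin p → K)}
    (hc : c ∈ cocycles K p (-1) (vermaRho K p 0 lam) (trivRho K)) :
    ∃ b ∈ coboundaries K p (-1) (vermaRho K p 0 lam) (trivRho K),
      (c - b) (-1) 1 = 0 ∧ (c - b) 0 1 = 0 := by
  have hp1 : ((p - 1 : ℕ) : K) = -1 := by
    rw [Nat.cast_sub (by omega), CharP.cast_eq_zero K p]
    simp
  obtain ⟨-, hbr, hpc⟩ := (mem_cocycles_iff lam c hp).mp hc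
  -- the `v_0`-coordinate of the value at `e_{-1}` vanishes
  have hv0 : coord (c (-1) 1) 0 = 0 := by
    have := congrArg (fun x => coord x (p - 1)) (hpc (-1) le_rfl (by omega))
    rw [coord_vermaRho_neg_one_pow lam _ (p - 1) (p - 1) (Nat.sub_lt (by omega) one_pos),
      if_pos le_rfl, Nat.sub_self] at this
    simpa using this
  -- the value at `e_0` vanishes in weight zero
  have hw0 : lam = -1 → coord (c 0 1) (p - 1) = 0 := by
    rintro h
    have := congrArg (fun x => coord x (p - 1)) (hpc 0 (by omega) (by omega))
    simp only [coord_vermaRho_zero_pow lam hp, hp1, if_true] at this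
    rw [← this, h, sub_self, zero_pow (by omega), zero_mul]
  let u : Fin p → K := fun k =>
    if (k : ℕ) = p - 1 then coord (c 0 1) (p - 1) / (lam + 1) else coord (c (-1) 1) (k + 1)
  have hu (k : ℕ) (hk : k < p) : coord u k =
      if k = p - 1 then coord (c 0 1) (p - 1) / (lam + 1) else coord (c (-1) 1) (k + 1) := by
    rw [coord, dif_pos hk]
  let b : ℤ → K →ₗ[K] (Fin p → K) := fun j =>
    LinearMap.toSpanSingleton K _ (vermaRho K p 0 lam j u)
  have hb : b ∈ coboundaries K p (-1) (vermaRho K p 0 lam) (trivRho K) :=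
    (mem_coboundaries_iff hp lam b).mpr ⟨u, fun j => by simp [b]⟩
  obtain ⟨-, hbr', -⟩ := (mem_cocycles_iff lam (c - b) hp).mp
    (Submodule.sub_mem _ hc (coboundaries_le_cocycles hp hlam hb))
  have hneg : (c - b) (-1) 1 = 0 := by
    refine coord_ext fun k hk => ?_
    simp only [Pi.sub_apply, LinearMap.sub_apply, b, LinearMap.toSpanSingleton_apply, one_smul,
      coord_sub, coord_zero, coord_vermaRho_neg_one]
    rcases Nat.eq_zero_or_pos k with rfl | h
    · simp [hv0]
    · rw [if_pos ⟨h, hk⟩, hu _ (by omega), if_neg (by omega), Nat.sub_add_cancel h, sub_self]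
  refine ⟨b, hb, hneg, coord_ext fun k hk => ?_⟩
  by_cases hk' : k = p - 1
  · simp only [Pi.sub_apply, LinearMap.sub_apply, b, LinearMap.toSpanSingleton_apply, one_smul,
      coord_sub, coord_zero, coord_vermaRho_zero lam hp]
    rw [hu k hk, if_pos hk', hk', hp1, sub_neg_eq_add]
    by_cases h : lam + 1 = 0
    · rw [hw0 (eq_neg_of_add_eq_zero_left h), h]
      simp
    · rw [mul_div_cancel₀ _ h, sub_self]
  · have := congrArg (fun x => coord x (k + 1)) (hbr' (-1) 0 (by omega) (by omega) (by omega)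
      (by omega))
    simp only [hneg, map_zero, sub_zero] at this
    rw [show (-1 : ℤ) + 0 = -1 by rfl, hneg] at this
    rw [coord_vermaRho_neg_one, if_pos (by omega), smul_zero, coord_zero,
      Nat.add_sub_cancel] at this
    rw [← this, coord_zero]

/-- A normalized cocycle vanishes unless its weight-zero part in degree `1` or `2` is nonzero. -/
lemma eq_zero_of_normalized (hp : 3 < p) {lam : K}
    {c : ℤ → K →ₗ[K] (Fin p → K)}
    (hc : c ∈ cocycles K p (-1) (vermaRho K p 0 lam) (trivRho K))
    (hneg : c (-1) 1 = 0) (h0 : c 0 1 = 0)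
    (h1 : lam = 0 → coord (c 1 1) (p - 1) = 0) (h2 : lam = 1 → coord (c 2 1) (p - 1) = 0) :
    c = 0 := by
  have hp1 : ((p - 1 : ℕ) : K) = -1 := by
    rw [Nat.cast_sub (by omega), CharP.cast_eq_zero K p]
    simp
  obtain ⟨hs, hbr, -⟩ := (mem_cocycles_iff lam c hp).mp hc
  have key (j : ℕ) : j + 2 ≤ p → c j 1 = 0 := by
    induction j using Nat.strong_induction_on with
    | _ j ih =>
    intro hj
    rcases Nat.eq_zero_or_pos j with rfl | hj0
    · simpa using h0
    have hlow (k : ℕ) (hk : k + 1 < p) : coord (c j 1) k = 0 := by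
      have := congrArg (fun x => coord x (k + 1)) (hbr (-1) j (by omega) (by omega) (by omega)
        (by omega))
      simp only [hneg, map_zero, sub_zero] at this
      rw [show (-1 : ℤ) + j = ((j - 1 : ℕ) : ℤ) by omega, ih (j - 1) (by omega) (by omega),
        coord_vermaRho_neg_one, if_pos (by omega), smul_zero, coord_zero,
        Nat.add_sub_cancel] at this
      exact this.symm
    have htop : coord (c j 1) (p - 1) = 0 := by
      by_contra hne
      have hw := congrArg (fun x => coord x (p - 1)) (hbr 0 j (by omega) (by omega) (by omega)
        (by omega))
      simp only [h0, map_zero, sub_zero, zero_add, coord_smul, coord_vermaRho_zero lam hp,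
        hp1] at hw
      have hl : (j : K) = lam + 1 := by
        have := mul_right_cancel₀ hne hw
        simpa using this
      rcases (by omega : j = 1 ∨ j = 2 ∨ 3 ≤ j) with rfl | rfl | h3
      · exact hne (h1 (by simpa using hl))
      · refine hne (h2 ?_)
        push_cast at hl
        linear_combination -hl
      · have h := hbr 1 ((j - 1 : ℕ) : ℤ) (by omega) (by omega) (by omega) (by omega)
        have e1 := ih 1 (by omega) (by omega)
        rw [Nat.cast_one] at e1
        simp only [ih (j - 1) (by omega) (by omega), e1, map_zero, sub_zero] at h
        rw [show (1 : ℤ) + ((j - 1 : ℕ) : ℤ) = j by omega,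
          show (((j - 1 : ℕ) : ℤ) - 1) = ((j - 2 : ℕ) : ℤ) by omega, Int.cast_natCast,
          smul_eq_zero_iff_right (natCast_ne_zero_of_lt (by omega) (by omega))] at h
        rw [h, coord_zero] at hne
        exact hne rfl
    refine coord_ext fun k hk => ?_
    rw [coord_zero]
    rcases (by omega : k + 1 < p ∨ k = p - 1) with h | rfl
    · exact hlow k h
    · exact htop
  refine funext fun j => LinearMap.ext_ring ?_
  rw [Pi.zero_apply, LinearMap.zero_apply]
  by_cases hj : j < -1 ∨ (p : ℤ) - 2 < j
  · exact hs j hj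
  · rcases (by omega : j = -1 ∨ 0 ≤ j) with rfl | hj0
    · exact hneg
    · lift j to ℕ using hj0
      exact key j (by omega)

lemma neg_one_pow_mul_descFactorial_mul_factorial {l n : ℕ} (h : l + n + 1 = p) (i : ℕ) :
    (-1 : K) ^ i * (l.descFactorial i : K) * (n ! : K) = ((n + i)! : K) := by
  have hpK : ((l : K) + n + 1) = 0 := by
    rw [← CharP.cast_eq_zero K p, ← h]
    push_cast
    ring
  induction i with
  | zero => simp
  | succ i ih =>
    rw [Nat.descFactorial_succ, ← add_assoc, Nat.factorial_succ]
    push_cast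
    rw [← ih]
    rcases le_or_gt i l with hi | hi
    · rw [Nat.cast_sub hi]
      linear_combination - (-1 : K) ^ i * (l.descFactorial i : K) * (n ! : K) * hpK
    · rw [Nat.descFactorial_of_lt hi]
      simp

lemma wCoef_mul_coord_genVec_one {i j k : ℕ} (hj : j + 2 ≤ p) (h : k + i + j = p) :
    wCoef K 0 i (k + i) * coord (genVec K p 1 j) (k + i) =
      (j : K) * (j + 1) * ((i + j)! : K) := by
  rw [coord_genVec, wCoef]
  cases j with
  | zero =>
    rw [if_neg (by omega)]
    simp
  | succ n =>
    have key := neg_one_pow_mul_descFactorial_mul_factorial (K := K) (p := p) (l := k + i)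
      (n := n) (by omega) i
    have hpK : ((k : K) + i + n + 1) = 0 := by
      rw [← CharP.cast_eq_zero K p, ← h]
      push_cast
      ring
    rw [if_pos (by omega), show i + (n + 1) = n + i + 1 by omega, Nat.factorial_succ (n + i),
      Nat.factorial_succ (n + 1), Nat.factorial_succ n]
    push_cast
    rw [← key]
    linear_combination (-1 : K) ^ (i + 1) * ((k + i).descFactorial i : K) * (n ! : K) *
      (n + 2) * (n + 1) * hpK

lemma wCoef_mul_coord_genVec_two {i j k : ℕ} (hj : j + 2 ≤ p) (h : k + i + j = p + 1) :
    wCoef K 1 i (k + i) * coord (genVec K p 2 j) (k + i) =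
      (j : K) * (j + 1) * (j - 1) * (2 * i + j) * ((i + j - 2)! : K) := by
  rw [coord_genVec, wCoef]
  obtain rfl | rfl | ⟨n, rfl⟩ : j = 0 ∨ j = 1 ∨ ∃ n, j = n + 2 := by
    rcases j with _ | _ | n <;> simp
  · rw [if_neg (by omega)]
    simp
  · rw [if_neg (by omega)]
    simp
  · have key := neg_one_pow_mul_descFactorial_mul_factorial (K := K) (p := p) (l := k + i)
      (n := n) (by omega) i
    have hpK : ((k : K) + i + n + 1) = 0 := by
      rw [← CharP.cast_eq_zero K p, show p = k + i + n + 1 by omega]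
      push_cast
      ring
    rw [if_pos (by omega), show i + (n + 2) - 2 = n + i by omega,
      Nat.factorial_succ (n + 2), Nat.factorial_succ (n + 1), Nat.factorial_succ n]
    push_cast
    rw [← key]
    linear_combination (-1 : K) ^ (i + 1) * ((k + i).descFactorial i : K) * (n ! : K) *
      (n + 3) * (n + 2) * (n + 1) * hpK

lemma satisfiesBracket_genVec (hp : 3 < p) {lam : K} {m : ℕ}
    (hm : m = 1 ∧ lam = 0 ∨ m = 2 ∧ lam = 1) :
    SatisfiesBracket lam (genVec K p m) := by
  refine satisfiesBracket_of_nat (fun i j hi hj => coord_ext fun k hk => ?_)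
    (fun j hj => coord_ext fun k hk => ?_)
  · rw [coord_smul, coord_sub, coord_vermaRho_nat lam hi, coord_vermaRho_nat lam hj,
      coord_genVec]
    by_cases h : k + i + j + 1 = p + m
    · have hfac : (if k < p ∧ i + j + 2 ≤ p ∧ k + (i + j) + 1 = p + m
          then ((i + j + 1)! : K) else 0) = ((i + j + 1)! : K) := by
        by_cases h' : i + j + 2 ≤ p
        · rw [if_pos (by omega)]
        · rw [if_neg (by omega), eq_comm, CharP.cast_eq_zero_iff K p]
          exact Nat.dvd_factorial (by omega) (by omega)
      rw [hfac]
      rcases hm with ⟨rfl, rfl⟩ | ⟨rfl, rfl⟩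
      · rw [wCoef_mul_coord_genVec_one hj (by omega), wCoef_mul_coord_genVec_one hi (by omega),
          add_comm j i, Nat.factorial_succ]
        push_cast
        ring
      · rw [wCoef_mul_coord_genVec_two hj (by omega), wCoef_mul_coord_genVec_two hi (by omega),
          add_comm j i]
        obtain ⟨s, hs⟩ : ∃ s, i + j = s + 2 := ⟨i + j - 2, by omega⟩
        have hsK : (i : K) + j = s + 2 := by exact_mod_cast congrArg (Nat.cast (R := K)) hs
        rw [hs, Nat.add_sub_cancel, Nat.factorial_succ (s + 2), Nat.factorial_succ (s + 1),
          Nat.factorial_succ s]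
        push_cast
        rw [show (s : K) = i + j - 2 by rw [hsK]; ring]
        ring
    · rw [if_neg (by omega), coord_genVec, coord_genVec, if_neg (by omega), if_neg (by omega)]
      simp
  · have h1 : genVec K p m (-1) = 0 := by
      funext k
      simp [genVec]
    have hm' : m = 1 ∨ m = 2 := hm.imp And.left And.left
    rw [h1, map_zero, sub_zero, coord_smul, coord_vermaRho_neg_one, coord_genVec]
    cases j with
    | zero =>
      rw [show ((0 : ℕ) : ℤ) - 1 = -1 by rfl, h1, coord_zero, mul_zero,
        if_neg (c := k - 1 < p ∧ _) (by omega), ite_self]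
    | succ n =>
      rw [show ((n + 1 : ℕ) : ℤ) - 1 = (n : ℤ) by push_cast; ring, coord_genVec]
      by_cases h : k + n + 1 = p + m
      · rw [if_pos (by omega), if_pos (by omega), if_pos (by omega),
          Nat.factorial_succ (n + 1)]
        push_cast
        ring
      · rw [if_neg (by omega), mul_zero]
        by_cases h' : 1 ≤ k ∧ k < p
        · rw [if_pos h', if_neg (by omega)]
        · rw [if_neg h']

lemma genCochain_mem_cocycles (hp : 3 < p) {lam : K} {m : ℕ}
    (hm : m = 1 ∧ lam = 0 ∨ m = 2 ∧ lam = 1) :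
    genCochain K p m ∈ cocycles K p (-1) (vermaRho K p 0 lam) (trivRho K) := by
  rw [mem_cocycles_iff lam _ hp]
  simp only [genCochain, LinearMap.toSpanSingleton_apply, one_smul]
  have hm' : m = 1 ∨ m = 2 := hm.imp And.left And.left
  have h0 : genVec K p m 0 = 0 := by
    funext k
    have := k.isLt
    rw [genVec, if_neg (by omega), Pi.zero_apply]
  refine ⟨fun k hk => ?_, satisfiesBracket_genVec hp hm, fun i hi hi' => ?_⟩
  · funext l
    rw [genVec, if_neg (by omega), Pi.zero_apply]
  · rw [h0, ite_self]
    obtain rfl | hi0 := hi.eq_or_lt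
    · have h1 : genVec K p m (-1) = 0 := by
        funext k
        simp [genVec]
      rw [h1, map_zero]
    · lift i to ℕ using by omega
      rcases (by omega : i = 0 ∨ i = 1 ∨ 2 ≤ i) with rfl | rfl | h
      · rw [Nat.cast_zero, h0, map_zero]
      · rcases hm with ⟨rfl, rfl⟩ | ⟨rfl, rfl⟩
        · refine coord_ext fun k hk => ?_
          rw [coord_zero]
          obtain ⟨q, hq⟩ : ∃ q, p - 1 = q + 1 := ⟨p - 2, by omega⟩
          rw [hq]
          rcases Nat.eq_zero_or_pos k with rfl | hk0
          · rw [pow_succ', Module.End.mul_apply, coord_vermaRho_nat 0 (by omega)]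
            simp [wCoef]
          · exact coord_vermaRho_nat_pow 0 (by omega) _ _ _ (by omega)
        · have : genVec K p 2 ((1 : ℕ) : ℤ) = 0 := by
            funext k
            have := k.isLt
            rw [genVec, if_neg (by push_cast; omega), Pi.zero_apply]
          rw [this, map_zero]
      · refine coord_ext fun k hk => ?_
        rw [coord_zero]
        have : 2 * (p - 1) ≤ i * (p - 1) := Nat.mul_le_mul_right _ h
        exact coord_vermaRho_nat_pow lam (by omega) _ _ _ (by omega)

/-- The top coordinate of `genCochain` in degree `m` is a nonzero factorial. -/
lemma coord_genCochain_ne_zero (hp : 3 < p) {m : ℕ} (hm : m = 1 ∨ m = 2) :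
    coord (genCochain K p m m 1) (p - 1) ≠ 0 := by
  have hprime : p.Prime := (CharP.char_is_prime_or_zero K p).resolve_right (by omega)
  rw [genCochain, LinearMap.toSpanSingleton_apply, one_smul, coord_genVec, if_pos (by omega),
    Ne, CharP.cast_eq_zero_iff K p, hprime.dvd_factorial]
  omega

lemma mem_coboundaries_of_ne (hp : 3 < p) {lam : K} (hlam : lam ^ p = lam)
    {c : ℤ → K →ₗ[K] (Fin p → K)}
    (hc : c ∈ cocycles K p (-1) (vermaRho K p 0 lam) (trivRho K))
    (h0 : lam ≠ 0) (h1 : lam ≠ 1) :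
    c ∈ coboundaries K p (-1) (vermaRho K p 0 lam) (trivRho K) := by
  obtain ⟨b, hb, hneg, hz⟩ := exists_normalized hp hlam hc
  have := eq_zero_of_normalized hp
    (Submodule.sub_mem _ hc (coboundaries_le_cocycles hp hlam hb)) hneg hz
    (fun h => absurd h h0) (fun h => absurd h h1)
  rwa [sub_eq_zero.mp this]

lemma exists_smul_genCochain_sub_mem (hp : 3 < p) {lam : K} (hlam : lam ^ p = lam) {m : ℕ}
    (hm : m = 1 ∧ lam = 0 ∨ m = 2 ∧ lam = 1) {c : ℤ → K →ₗ[K] (Fin p → K)}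
    (hc : c ∈ cocycles K p (-1) (vermaRho K p 0 lam) (trivRho K)) :
    ∃ a : K, a • genCochain K p m - c ∈
      coboundaries K p (-1) (vermaRho K p 0 lam) (trivRho K) := by
  obtain ⟨b, hb, hneg, hz⟩ := exists_normalized hp hlam hc
  have hm' : m = 1 ∨ m = 2 := hm.imp And.left And.left
  have hne := coord_genCochain_ne_zero (K := K) hp hm'
  set a : K := coord ((c - b) m 1) (p - 1) / coord (genCochain K p m m 1) (p - 1) with ha
  have htop : coord ((c - b - a • genCochain K p m) m 1) (p - 1) = 0 := by
    rw [Pi.sub_apply, LinearMap.sub_apply, Pi.smul_apply, LinearMap.smul_apply, coord_sub,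
      coord_smul, ha, div_mul_cancel₀ _ hne, sub_self]
  have := eq_zero_of_normalized (c := c - b - a • genCochain K p m) (lam := lam) hp
    (Submodule.sub_mem _ (Submodule.sub_mem _ hc (coboundaries_le_cocycles hp hlam hb))
      (Submodule.smul_mem _ _ (genCochain_mem_cocycles hp hm)))
    (by rw [Pi.sub_apply, LinearMap.sub_apply, hneg, Pi.smul_apply, LinearMap.smul_apply,
          genCochain_neg_one, smul_zero, sub_zero])
    (by rw [Pi.sub_apply, LinearMap.sub_apply, hz, Pi.smul_apply, LinearMap.smul_apply,
          genCochain_zero hm', smul_zero, sub_zero])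
    (by
      rintro rfl
      rcases hm with ⟨rfl, -⟩ | ⟨-, h⟩
      · exact htop
      · exact absurd h zero_ne_one)
    (by
      rintro rfl
      rcases hm with ⟨-, h⟩ | ⟨rfl, -⟩
      · exact absurd h one_ne_zero
      · exact htop)
  refine ⟨a, ?_⟩
  rw [← neg_mem_iff, neg_sub]
  rw [sub_right_comm, sub_eq_zero] at this
  rwa [this]

lemma genCochain_notMem_coboundaries (hp : 3 < p) {lam : K} {m : ℕ}
    (hm : m = 1 ∧ lam = 0 ∨ m = 2 ∧ lam = 1) :
    genCochain K p m ∉ coboundaries K p (-1) (vermaRho K p 0 lam) (trivRho K) := by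
  rw [mem_coboundaries_iff hp]
  rintro ⟨u, hu⟩
  have hm' : m = 1 ∨ m = 2 := hm.imp And.left And.left
  refine coord_genCochain_ne_zero (K := K) hp hm' ?_
  have hmp : m + 2 ≤ p := by omega
  rw [hu, coord_vermaRho_nat lam hmp, coord_of_le u (by omega), mul_zero]

end VermaCohomology

open scoped Classical in
/-- For `χ = 0` and `λ ∈ F_p`, in the category of restricted `W`-modules,
`Ext(K, V_0(λ)) ≅ K` if `λ ∈ {0, 1}` and `Ext(K, V_0(λ)) = 0` otherwise. -/
theorem ext_trivial_verma
    (K : Type) [Field K] [IsAlgClosed K] (p : ℕ) [CharP K p] (hp : 3 < p)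
    (lam : K) (hlam : lam ^ p = lam) :
    Module.finrank K (extSpace K p (-1) (vermaRho K p 0 lam) (trivRho K))
      = if lam = 0 ∨ lam = 1 then 1 else 0 := by
  by_cases h : lam = 0 ∨ lam = 1
  · rw [if_pos h]
    obtain ⟨m, hm⟩ : ∃ m : ℕ, m = 1 ∧ lam = 0 ∨ m = 2 ∧ lam = 1 := by
      rcases h with h | h
      · exact ⟨1, Or.inl ⟨rfl, h⟩⟩
      · exact ⟨2, Or.inr ⟨rfl, h⟩⟩
    refine finrank_eq_one
      (Submodule.Quotient.mk ⟨genCochain K p m, genCochain_mem_cocycles hp hm⟩) ?_ ?_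
    · rw [Ne, Submodule.Quotient.mk_eq_zero]
      exact genCochain_notMem_coboundaries hp hm
    · intro x
      obtain ⟨⟨c, hc⟩, rfl⟩ := Submodule.Quotient.mk_surjective _ x
      obtain ⟨a, ha⟩ := exists_smul_genCochain_sub_mem hp hlam hm hc
      refine ⟨a, ?_⟩
      rw [← Submodule.Quotient.mk_smul, Submodule.Quotient.eq]
      exact ha
  · rw [if_neg h]
    push Not at h
    have : Subsingleton (extSpace K p (-1) (vermaRho K p 0 lam) (trivRho K)) := by
      refine Submodule.Quotient.subsingleton_iff.mpr (eq_top_iff.mpr ?_)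
      rintro ⟨c, hc⟩ -
      exact mem_coboundaries_of_ne hp hlam hc h.1 h.2
    exact Module.finrank_zero_of_subsingleton
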